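/- Equivalence of LP objective and weighted L¹ projection (Lemma 3, abstract form): let V* be the fixed point of a monotone γ-contraction T, let c be a finite positive measure on X, and let F := {V̂ ∈ S : V̂ ≤ T V̂ pointwise} for a subspace S. Every V̂ ∈ F satisfies V̂ ≤ V*, and therefore ∫ |V* − V̂| dc = ∫ V* dc − ∫ V̂ dc; consequently, maximizing ∫ V̂ dc over F is equivalent to minimizing ‖V* − V̂‖_{1,c} = ∫ |V* − V̂| dc over F. -/

import Mathlib

open MeasureTheory

/-- Equivalence of LP objective and weighted L¹ projection (Lemma 3, abstract form):
let `V*` be the bounded fixed point of a monotone `γ`-contraction `T`, `c` a finite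
measure, and `F := {V̂ ∈ S : V̂ ≤ T V̂}`. Every `V̂ ∈ F` satisfies `V̂ ≤ V*` and
`∫ |V* − V̂| dc = ∫ V* dc − ∫ V̂ dc`; hence maximizing `∫ V̂ dc` over `F` is
equivalent to minimizing `‖V* − V̂‖_{1,c}` over `F`. -/
theorem lp_objective_equiv_weighted_l1
    {X : Type*} [MeasurableSpace X] [Nonempty X]
    (c : Measure X) [IsFiniteMeasure c]
    (T : (X → ℝ) → (X → ℝ)) (γ : ℝ) (hγ0 : 0 < γ) (hγ1 : γ < 1)
    (hmono : ∀ V₁ V₂ : X → ℝ, (∀ x, V₁ x ≤ V₂ x) → ∀ x, T V₁ x ≤ T V₂ x)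
    (hmaps : ∀ V : X → ℝ, (∃ C, ∀ x, |V x| ≤ C) → ∃ C, ∀ x, |T V x| ≤ C)
    (hcontr : ∀ V₁ V₂ : X → ℝ, (∃ C, ∀ x, |V₁ x| ≤ C) → (∃ C, ∀ x, |V₂ x| ≤ C) →
      (⨆ x, |T V₁ x - T V₂ x|) ≤ γ * ⨆ x, |V₁ x - V₂ x|)
    (Vstar : X → ℝ) (hVstarb : ∃ C, ∀ x, |Vstar x| ≤ C)
    (hVstari : Integrable Vstar c) (hfix : T Vstar = Vstar)
    (S : Set (X → ℝ))
    (hSb : ∀ V ∈ S, ∃ C, ∀ x, |V x| ≤ C)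
    (hSi : ∀ V ∈ S, Integrable V c)
    (F : Set (X → ℝ)) (hF : F = {V ∈ S | ∀ x, V x ≤ T V x}) :
    (∀ V ∈ F, (∀ x, V x ≤ Vstar x) ∧
      ∫ x, |Vstar x - V x| ∂c = (∫ x, Vstar x ∂c) - ∫ x, V x ∂c) ∧
    (∀ V₁ ∈ F, ∀ V₂ ∈ F,
      ((∫ x, V₁ x ∂c) ≤ ∫ x, V₂ x ∂c ↔
        (∫ x, |Vstar x - V₂ x| ∂c) ≤ ∫ x, |Vstar x - V₁ x| ∂c)) := by
  have key : ∀ V ∈ F, ∀ x, V x ≤ Vstar x := by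
    intro V hV
    rw [hF] at hV
    obtain ⟨hVS, hVT⟩ := hV
    obtain ⟨C, hC⟩ := hSb V hVS
    obtain ⟨D, hD⟩ := hVstarb
    have hWb : ∃ C, ∀ x, |(fun x => max (V x) (Vstar x)) x| ≤ C :=
      ⟨max C D, fun x => (abs_max_le_max_abs_abs).trans (max_le_max (hC x) (hD x))⟩
    have hWT : ∀ x, max (V x) (Vstar x) ≤ T (fun x => max (V x) (Vstar x)) x := by
      intro x
      refine max_le ((hVT x).trans (hmono _ _ (fun y => le_max_left _ _) x)) ?_
      have h := hmono Vstar (fun x => max (V x) (Vstar x)) (fun y => le_max_right _ _) x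
      rwa [hfix] at h
    have hc := hcontr _ Vstar hWb ⟨D, hD⟩
    have hTb := hmaps _ hWb
    rw [hfix] at hc
    generalize hTW : T (fun x => max (V x) (Vstar x)) = U at *
    obtain ⟨E, hE⟩ := hWb
    obtain ⟨G, hG⟩ := hTb
    have b1 : BddAbove (Set.range fun x => |max (V x) (Vstar x) - Vstar x|) := by
      refine ⟨E + D, ?_⟩
      rintro _ ⟨x, rfl⟩
      exact (abs_sub _ _).trans (add_le_add (hE x) (hD x))
    have b2 : BddAbove (Set.range fun x => |U x - Vstar x|) := by
      refine ⟨G + D, ?_⟩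
      rintro _ ⟨x, rfl⟩
      exact (abs_sub _ _).trans (add_le_add (hG x) (hD x))
    have h1 : (⨆ x, |max (V x) (Vstar x) - Vstar x|) ≤ ⨆ x, |U x - Vstar x| := by
      refine ciSup_mono b2 fun x => ?_
      have := le_max_right (V x) (Vstar x)
      exact abs_le_abs_of_nonneg (by linarith) (by linarith [hWT x])
    intro x
    have h2 := le_ciSup b1 x
    have h3 := le_abs_self (max (V x) (Vstar x) - Vstar x)
    have h4 := le_max_left (V x) (Vstar x)
    have h5 : (⨆ x, |max (V x) (Vstar x) - Vstar x|) ≤ 0 := by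
      by_contra! h
      nlinarith
    linarith
  have key2 : ∀ V ∈ F, ∫ x, |Vstar x - V x| ∂c = (∫ x, Vstar x ∂c) - ∫ x, V x ∂c := by
    intro V hV
    have hVS : V ∈ S := by rw [hF] at hV; exact hV.1
    rw [← integral_sub hVstari (hSi V hVS)]
    congr 1
    ext x
    exact abs_of_nonneg (sub_nonneg.2 (key V hV x))
  refine ⟨fun V hV => ⟨key V hV, key2 V hV⟩, fun V₁ h₁ V₂ h₂ => ?_⟩
  rw [key2 V₁ h₁, key2 V₂ h₂]
  exact (sub_le_sub_iff_left _).symm
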